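/- There is an absolute constant C such that for every unary language L ⊆ {a}* and every udpda A of size m with L(A) = L, there exists an indicator pair for L of size at most C·m. -/

import Mathlib

/-- A straight-line program in Chomsky normal form over alphabet `α`:
nonterminals are `Fin n`, each production is either a terminal or a pair of
nonterminals with strictly smaller indices (this index condition is a
topological ordering witnessing acyclicity of the SLP).  The size of such an
SLP is its number `n` of nonterminals. -/
structure CnfSLP (α : Type) where
  n : ℕ
  ax : Fin n
  prod : Fin n → α ⊕ (Fin n × Fin n)
  wf : ∀ (i B C : Fin n), prod i = Sum.inr (B, C) → B < i ∧ C < i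

namespace CnfSLP

variable {α : Type}

/-- The word generated by nonterminal `i`. -/
def strAt (P : CnfSLP α) : Fin P.n → List α
  | i =>
    match h : P.prod i with
    | Sum.inl a => [a]
    | Sum.inr (B, C) => P.strAt B ++ P.strAt C
termination_by i => i.val
decreasing_by
  · exact (P.wf i B C h).1
  · exact (P.wf i B C h).2

/-- The word generated by the SLP (from its axiom). -/
def str (P : CnfSLP α) : List α := P.strAt P.ax

/-- The size of an SLP: the number of nonterminals (in Chomsky normal form). -/
def size (P : CnfSLP α) : ℕ := P.n

end CnfSLP

/-- `Generates u w c` means the infinite sequence `u · w^ω` is well defined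
(`w` is nonempty) and equals the sequence `c`. -/
def Generates {α : Type} (u w : List α) (c : ℕ → α) : Prop :=
  w ≠ [] ∧ ∀ i : ℕ,
    (if i < u.length then u[i]? else w[(i - u.length) % w.length]?) = some (c i)

/-- `(P1, P2)` is an indicator pair for the unary language `L ⊆ {a}*`
(identified with the set of lengths of its words): the pair of SLPs over
`{0,1}` (here `Bool`, with `true` playing the role of `1`) generates the
characteristic sequence of `L`. -/
def IsIndicatorPair (P1 P2 : CnfSLP Bool) (L : Set ℕ) : Prop :=
  ∃ c : ℕ → Bool, (∀ i, (c i = true ↔ i ∈ L)) ∧ Generates P1.str P2.str c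

/-- The data of a unary pushdown automaton over the input alphabet `{a}`
(a transition whose `Bool` component is `true` reads `a`, otherwise it
reads `ε`): bottom-of-stack symbol, initial state, final states, transitions. -/
structure PrePDA (Q Γ : Type) where
  bot : Γ
  init : Q
  final : Set Q
  δ : Set (Q × Bool × Γ × Q × List Γ)

namespace PrePDA

variable {Q Γ : Type}

/-- Valid stack contents: a word in `(Γ∖{⊥})*⊥`. -/
def IsStack (A : PrePDA Q Γ) (s : List Γ) : Prop :=
  ∃ s', A.bot ∉ s' ∧ s = s' ++ [A.bot]

/-- A move from configuration `c1` to `c2` reading `a` (if `σ = true`)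
or `ε` (if `σ = false`). -/
def Move (A : PrePDA Q Γ) (c1 : Q × List Γ) (σ : Bool) (c2 : Q × List Γ) : Prop :=
  ∃ γ w, (c1.1, σ, γ, c2.1, w) ∈ A.δ ∧
    (((γ ≠ A.bot ∨ w ≠ []) ∧ ∃ s', c1.2 = γ :: s' ∧ c2.2 = w ++ s') ∨
      (γ = A.bot ∧ w = [] ∧ c1.2 = [A.bot] ∧ c2.2 = [A.bot]))

/-- `Steps A c1 k c2`: there is a finite computation from `c1` to `c2`
reading the word `a^k`. -/
inductive Steps (A : PrePDA Q Γ) : Q × List Γ → ℕ → Q × List Γ → Prop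
  | refl (c : Q × List Γ) : Steps A c 0 c
  | tail {c1 : Q × List Γ} {k : ℕ} {c2 : Q × List Γ} {σ : Bool} {c3 : Q × List Γ} :
      Steps A c1 k c2 → A.Move c2 σ c3 → Steps A c1 (k + (if σ then 1 else 0)) c3

/-- The language of the automaton, as a set of natural numbers:
`a^k` is accepted iff `k` is in this set (acceptance by final state,
starting from the configuration `(q₀, ⊥)`). -/
def lang (A : PrePDA Q Γ) : Set ℕ :=
  {k | ∃ c : Q × List Γ, A.Steps (A.init, [A.bot]) k c ∧ c.1 ∈ A.final}

end PrePDA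

/-- A unary deterministic pushdown automaton (udpda): finitely many states and
stack symbols, well-formed transitions (each pushed word has length at most 2,
and the bottom symbol is neither pushed above other symbols nor removed), and
at most one move available at every configuration. -/
structure UDPDA (Q Γ : Type) extends PrePDA Q Γ where
  finQ : Finite Q
  finΓ : Finite Γ
  wf : ∀ q1 σ γ q2 w, (q1, σ, γ, q2, w) ∈ δ →
    w.length ≤ 2 ∧
      ((γ ≠ bot ∧ bot ∉ w) ∨ (γ = bot ∧ (w = [] ∨ ∃ w', bot ∉ w' ∧ w = w' ++ [bot])))
  det : ∀ c σ1 c1 σ2 c2, toPrePDA.IsStack c.2 →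
    toPrePDA.Move c σ1 c1 → toPrePDA.Move c σ2 c2 → σ1 = σ2 ∧ c1 = c2

namespace UDPDA

variable {Q Γ : Type}

/-- The size of a udpda: `|Q| · |Γ|`. -/
noncomputable def size (A : UDPDA Q Γ) : ℕ := Nat.card Q * Nat.card Γ

/-- The language of a udpda. -/
def lang (A : UDPDA Q Γ) : Set ℕ := A.toPrePDA.lang

end UDPDA

/-! ### Straight-line lists of words -/

/-- A list of words, each of which is a letter or a concatenation of two earlier words. -/
inductive SLList : List (List Bool) → Prop
  | nil : SLList []
  | single {S : List (List Bool)} (b : Bool) : SLList S → SLList ([b] :: S)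
  | cat {S : List (List Bool)} {x y : List Bool} : SLList S → x ∈ S → y ∈ S →
      SLList ((x ++ y) :: S)

def HasW (S : List (List Bool)) (x : List Bool) : Prop := x = [] ∨ x ∈ S

theorem HasW.mono {S S' : List (List Bool)} (h : S ⊆ S') {x : List Bool} (hx : HasW S x) :
    HasW S' x := hx.imp id (fun h' => h h')

theorem SLList.ext_cat {S : List (List Bool)} (hS : SLList S) {x y : List Bool}
    (hx : HasW S x) (hy : HasW S y) :
    ∃ S', SLList S' ∧ S ⊆ S' ∧ S'.length ≤ S.length + 1 ∧ HasW S' (x ++ y) := by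
  rcases hx with rfl | hx
  · exact ⟨S, hS, fun _ h => h, by omega, by simpa using hy⟩
  rcases hy with rfl | hy
  · exact ⟨S, hS, fun _ h => h, by omega, by simpa [HasW] using Or.inr hx⟩
  · exact ⟨_, .cat hS hx hy, fun _ h => List.mem_cons_of_mem _ h, by simp, Or.inr (by simp)⟩

theorem CnfSLP.strAt_inl {α : Type} (P : CnfSLP α) (i : Fin P.n) (a : α)
    (h : P.prod i = Sum.inl a) : P.strAt i = [a] := by
  rw [CnfSLP.strAt]
  split
  · rename_i a' h'
    rw [h] at h'; cases h'; rfl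
  · rename_i h'
    rw [h] at h'; cases h'

theorem CnfSLP.strAt_inr {α : Type} (P : CnfSLP α) (i B C : Fin P.n)
    (h : P.prod i = Sum.inr (B, C)) : P.strAt i = P.strAt B ++ P.strAt C := by
  rw [CnfSLP.strAt]
  split
  · rename_i h'
    rw [h] at h'; cases h'
  · rename_i h'
    rw [h] at h'; cases h'; rfl

/-- Index form of straight-line lists (index counted from the end of the list). -/
theorem SLList.index {S : List (List Bool)} (hS : SLList S) :
    ∀ i : Fin S.length, ∃ pr : Bool ⊕ (Fin S.length × Fin S.length),
      (∀ B C, pr = Sum.inr (B, C) → B < i ∧ C < i) ∧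
      (∀ b, pr = Sum.inl b → S.reverse[(i : ℕ)]? = some [b]) ∧
      (∀ B C, pr = Sum.inr (B, C) → ∃ x y, S.reverse[(B : ℕ)]? = some x ∧
        S.reverse[(C : ℕ)]? = some y ∧ S.reverse[(i : ℕ)]? = some (x ++ y)) := by
  induction hS with
  | nil => intro i; exact i.elim0
  | @single S b hS ih =>
    intro i
    by_cases hi : (i : ℕ) < S.length
    · obtain ⟨pr, h1, h2, h3⟩ := ih ⟨i, hi⟩
      refine ⟨pr.map id (Prod.map (Fin.castSucc) (Fin.castSucc)), ?_, ?_, ?_⟩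
      · rintro B C h
        rcases pr with b' | ⟨B', C'⟩
        · simp at h
        · simp at h
          have := h1 B' C' rfl
          rcases h with ⟨rfl, rfl⟩
          simpa [Fin.lt_def] using this
      · rintro b' h
        rcases pr with b'' | ⟨B', C'⟩
        · simp at h
          subst h
          have := h2 _ rfl
          simpa [List.getElem?_append_left, hi] using this
        · simp at h
      · rintro B C h
        rcases pr with b' | ⟨B', C'⟩
        · simp at h
        · simp at h
          obtain ⟨x, y, hx, hy, hxy⟩ := h3 B' C' rfl
          rcases h with ⟨rfl, rfl⟩
          refine ⟨x, y, ?_, ?_, ?_⟩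
          · simpa [List.getElem?_append_left] using hx
          · simpa [List.getElem?_append_left] using hy
          · simpa [List.getElem?_append_left, hi] using hxy
    · have hi' : (i : ℕ) = S.length := by have := i.2; simp at this; omega
      refine ⟨Sum.inl b, by simp, ?_, by simp⟩
      rintro b' h
      simp at h
      subst h
      simp [hi']
  | @cat S x y hS hx hy ih =>
    intro i
    by_cases hi : (i : ℕ) < S.length
    · obtain ⟨pr, h1, h2, h3⟩ := ih ⟨i, hi⟩
      refine ⟨pr.map id (Prod.map (Fin.castSucc) (Fin.castSucc)), ?_, ?_, ?_⟩
      · rintro B C h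
        rcases pr with b' | ⟨B', C'⟩
        · simp at h
        · simp at h
          have := h1 B' C' rfl
          rcases h with ⟨rfl, rfl⟩
          simpa [Fin.lt_def] using this
      · rintro b' h
        rcases pr with b'' | ⟨B', C'⟩
        · simp at h
          subst h
          have := h2 _ rfl
          simpa [List.getElem?_append_left, hi] using this
        · simp at h
      · rintro B C h
        rcases pr with b' | ⟨B', C'⟩
        · simp at h
        · simp at h
          obtain ⟨x, y, hx, hy, hxy⟩ := h3 B' C' rfl
          rcases h with ⟨rfl, rfl⟩
          refine ⟨x, y, ?_, ?_, ?_⟩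
          · simpa [List.getElem?_append_left] using hx
          · simpa [List.getElem?_append_left] using hy
          · simpa [List.getElem?_append_left, hi] using hxy
    · have hi' : (i : ℕ) = S.length := by have := i.2; simp at this; omega
      obtain ⟨jx, hjx, ex⟩ := List.getElem_of_mem (List.mem_reverse.2 hx)
      obtain ⟨jy, hjy, ey⟩ := List.getElem_of_mem (List.mem_reverse.2 hy)
      have hjx' : jx < S.length := by simpa using hjx
      have hjy' : jy < S.length := by simpa using hjy
      refine ⟨Sum.inr (⟨jx, by simp; omega⟩, ⟨jy, by simp; omega⟩), ?_, by simp, ?_⟩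
      · rintro B C h
        simp at h
        rcases h with ⟨rfl, rfl⟩
        simp [Fin.lt_def]; omega
      · rintro B C h
        simp only [Sum.inr.injEq, Prod.mk.injEq] at h
        rcases h with ⟨rfl, rfl⟩
        refine ⟨x, y, ?_, ?_, ?_⟩
        · rw [List.reverse_cons, List.getElem?_append_left hjx, List.getElem?_eq_getElem hjx, ex]
        · rw [List.reverse_cons, List.getElem?_append_left hjy, List.getElem?_eq_getElem hjy, ey]
        · simp [hi']

theorem SLList.toSLP {S : List (List Bool)} (hS : SLList S) {x : List Bool} (hx : x ∈ S) :
    ∃ P : CnfSLP Bool, P.str = x ∧ P.size = S.length := by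
  choose pr h1 h2 h3 using hS.index
  obtain ⟨j, hj, ex⟩ := List.getElem_of_mem (List.mem_reverse.2 hx)
  have hj' : j < S.length := by simpa using hj
  let P : CnfSLP Bool := ⟨S.length, ⟨j, hj'⟩, pr, h1⟩
  have key : ∀ k : ℕ, ∀ i : Fin P.n, (i : ℕ) = k → S.reverse[(i : ℕ)]? = some (P.strAt i) := by
    intro k
    induction k using Nat.strong_induction_on with
    | _ k ih =>
      intro i hi
      rcases hp : P.prod i with b | ⟨B, C⟩
      · rw [P.strAt_inl i b hp]
        exact h2 i b hp
      · rw [P.strAt_inr i B C hp]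
        obtain ⟨x, y, hx, hy, hxy⟩ := h3 i B C hp
        obtain ⟨hB, hC⟩ := h1 i B C hp
        rw [Fin.lt_def] at hB hC
        have eB := ih B (by omega) B rfl
        have eC := ih C (by omega) C rfl
        rw [hxy]
        rw [eB] at hx
        rw [eC] at hy
        simp at hx hy
        rw [hx, hy]
  refine ⟨P, ?_, rfl⟩
  have := key j ⟨j, hj'⟩ rfl
  simp only [List.getElem?_eq_getElem hj, ex, Option.some.injEq] at this
  exact this.symm

/-! ### Abstract machines: prefix rewriting of stacks with output -/

section Machine

variable {P Γ : Type}

/-- Computations with `n` moves and output. -/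
inductive MRun (D : P → Γ → List Bool → P → List Γ → Prop) (c : P × List Γ) :
    ℕ → List Bool → P × List Γ → Prop
  | refl : MRun D c 0 [] c
  | tail {n : ℕ} {o : List Bool} {p : P} {g : Γ} {r : List Γ} {o' : List Bool} {p' : P}
      {w : List Γ} : MRun D c n o (p, g :: r) → D p g o' p' w →
      MRun D c (n + 1) (o ++ o') (p', w ++ r)

inductive MPop (D : P → Γ → List Bool → P → List Γ → Prop) :
    P → Γ → List Bool → P → Prop
  | pop {p g o p'} : D p g o p' [] → MPop D p g o p'
  | repl {p g o p1 g1 x p'} : D p g o p1 [g1] → MPop D p1 g1 x p' → MPop D p g (o ++ x) p'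
  | push {p g o p1 g1 g2 x p2 y p'} : D p g o p1 [g1, g2] → MPop D p1 g1 x p2 →
      MPop D p2 g2 y p' → MPop D p g (o ++ (x ++ y)) p'

variable {D : P → Γ → List Bool → P → List Γ → Prop}

theorem MRun.trans {c1 c2 c3 : P × List Γ} {n m : ℕ} {o o' : List Bool}
    (h : MRun D c1 n o c2) (h' : MRun D c2 m o' c3) : MRun D c1 (n + m) (o ++ o') c3 := by
  induction h' with
  | refl => simpa using h
  | tail _ hd ih =>
    rw [← List.append_assoc, ← Nat.add_assoc]
    exact .tail ih hd

theorem MRun.one {p : P} {g : Γ} {r : List Γ} {o : List Bool} {p' : P} {w : List Γ}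
    (h : D p g o p' w) : MRun D (p, g :: r) 1 o (p', w ++ r) := by
  simpa using MRun.tail (MRun.refl (D := D) (c := (p, g :: r))) h

theorem MPop.run {p : P} {g : Γ} {x : List Bool} {p' : P} (h : MPop D p g x p') :
    ∀ r, ∃ n, 1 ≤ n ∧ MRun D (p, g :: r) n x (p', r) := by
  induction h with
  | pop h => intro r; exact ⟨1, le_rfl, by simpa using MRun.one (r := r) h⟩
  | repl h _ ih =>
    intro r
    obtain ⟨n, _, hr⟩ := ih r
    exact ⟨1 + n, by omega, (MRun.one (r := r) h).trans hr⟩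
  | @push p g o p1 g1 g2 x p2 y p' h _ _ ih1 ih2 =>
    intro r
    obtain ⟨n, _, hr⟩ := ih1 (g2 :: r)
    obtain ⟨m, _, hr'⟩ := ih2 r
    exact ⟨1 + (n + m), by omega, (MRun.one (r := r) h).trans (hr.trans hr')⟩

/-- Functionality of the transition relation. -/
def MDet (D : P → Γ → List Bool → P → List Γ → Prop) : Prop :=
  ∀ p g o p' w o2 p2 w2, D p g o p' w → D p g o2 p2 w2 → o = o2 ∧ p' = p2 ∧ w = w2

theorem MPop.det (hD : MDet D) {p : P} {g : Γ} {x : List Bool} {p' : P} (h : MPop D p g x p') :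
    ∀ {y : List Bool} {p'' : P}, MPop D p g y p'' → x = y ∧ p' = p'' := by
  induction h with
  | pop h =>
    intro y p'' h'
    cases h' with
    | pop h2 => obtain ⟨rfl, rfl, _⟩ := hD _ _ _ _ _ _ _ _ h h2; exact ⟨rfl, rfl⟩
    | repl h2 _ => exact absurd (hD _ _ _ _ _ _ _ _ h h2).2.2 (by simp)
    | push h2 _ _ => exact absurd (hD _ _ _ _ _ _ _ _ h h2).2.2 (by simp)
  | repl h _ ih =>
    intro y p'' h'
    cases h' with
    | pop h2 => exact absurd (hD _ _ _ _ _ _ _ _ h h2).2.2 (by simp)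
    | repl h2 k2 =>
      obtain ⟨rfl, rfl, e⟩ := hD _ _ _ _ _ _ _ _ h h2
      simp at e; subst e
      obtain ⟨rfl, rfl⟩ := ih k2
      exact ⟨rfl, rfl⟩
    | push h2 _ _ => exact absurd (hD _ _ _ _ _ _ _ _ h h2).2.2 (by simp)
  | push h _ _ ih1 ih2 =>
    intro y p'' h'
    cases h' with
    | pop h2 => exact absurd (hD _ _ _ _ _ _ _ _ h h2).2.2 (by simp)
    | repl h2 _ => exact absurd (hD _ _ _ _ _ _ _ _ h h2).2.2 (by simp)
    | push h2 k2 l2 =>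
      obtain ⟨rfl, rfl, e⟩ := hD _ _ _ _ _ _ _ _ h h2
      simp at e
      obtain ⟨rfl, rfl⟩ := e
      obtain ⟨rfl, rfl⟩ := ih1 k2
      obtain ⟨rfl, rfl⟩ := ih2 l2
      exact ⟨rfl, rfl⟩

/-- Runs from the same configuration are comparable. -/
theorem MRun.compare (hD : MDet D) {c c1 : P × List Γ} {n : ℕ} {o : List Bool}
    (h : MRun D c n o c1) {m : ℕ} {o2 : List Bool} {c2 : P × List Γ}
    (h2 : MRun D c m o2 c2) (hnm : n ≤ m) :
    ∃ o', o2 = o ++ o' ∧ MRun D c1 (m - n) o' c2 := by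
  induction h2 with
  | refl =>
    obtain rfl : n = 0 := by omega
    cases h
    exact ⟨[], rfl, .refl⟩
  | @tail k o3 p g r o' p' w h3 hd ih =>
    by_cases hk : n ≤ k
    · obtain ⟨o4, rfl, h4⟩ := ih hk
      refine ⟨o4 ++ o', by simp, ?_⟩
      rw [show k + 1 - n = (k - n) + 1 by omega]
      exact .tail h4 hd
    · obtain rfl : n = k + 1 := by omega
      clear ih hk hnm
      suffices H : o = o3 ++ o' ∧ c1 = (p', w ++ r) by
        obtain ⟨rfl, rfl⟩ := H
        exact ⟨[], by simp, by simpa using MRun.refl⟩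
      have aux : ∀ {k o o3 c1 c3}, MRun D c k o c1 → MRun D c k o3 c3 → o = o3 ∧ c1 = c3 := by
        intro k
        induction k with
        | zero => intro o o3 c1 c3 h1 h2; cases h1; cases h2; exact ⟨rfl, rfl⟩
        | succ k ih =>
          intro o o3 c1 c3 h1 h2
          cases h1 with
          | tail h1 d1 =>
            cases h2 with
            | tail h2 d2 =>
              obtain ⟨rfl, e⟩ := ih h1 h2
              simp at e
              obtain ⟨rfl, rfl, rfl⟩ := e
              obtain ⟨rfl, rfl, rfl⟩ := hD _ _ _ _ _ _ _ _ d1 d2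
              exact ⟨rfl, rfl⟩
      exact aux h (.tail h3 hd)

def MNonpop (D : P → Γ → List Bool → P → List Γ → Prop) (a : P × Γ) : Prop :=
  ∀ x p', ¬ MPop D a.1 a.2 x p'

/-- All words of popping computations are produced by a small straight-line list. -/
theorem exists_popList [Finite P] [Finite Γ] (hD : MDet D)
    (hO : ∀ p g o p' w, D p g o p' w → o = [] ∨ ∃ b, o = [b]) :
    ∃ S, SLList S ∧ S.length ≤ 2 + 2 * (Nat.card P * Nat.card Γ) ∧ (∀ b : Bool, [b] ∈ S) ∧
      ∀ p g x p', MPop D p g x p' → HasW S x := by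
  classical
  have := Fintype.ofFinite P
  have := Fintype.ofFinite Γ
  let good : Finset (P × Γ) → Prop := fun T =>
    ∃ S, SLList S ∧ S.length ≤ 2 + 2 * T.card ∧ (∀ b : Bool, [b] ∈ S) ∧
      ∀ p g x p', (p, g) ∈ T → MPop D p g x p' → HasW S x
  have h0 : good ∅ := ⟨[[true], [false]], .single _ (.single _ .nil), by simp, by simp, by simp⟩
  obtain ⟨T, hT, hmax⟩ := Finset.exists_max_image (Finset.univ.filter good) Finset.card
    ⟨∅, by simpa using h0⟩
  simp only [Finset.mem_filter, Finset.mem_univ, true_and] at hT hmax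
  obtain ⟨S, hS, hlen, hb, hpop⟩ := hT
  have hins : ∀ p g o x y p', MPop D p g (o ++ (x ++ y)) p' → HasW S o → HasW S x → HasW S y →
      (p, g) ∈ T := by
    intro p g o x y p' hP ho hx hy
    by_contra hn
    obtain ⟨S1, hS1, sub1, len1, h1⟩ := hS.ext_cat hx hy
    obtain ⟨S2, hS2, sub2, len2, h2⟩ := hS1.ext_cat (ho.mono sub1) h1
    have hg : good (insert (p, g) T) := by
      refine ⟨S2, hS2, ?_, fun b => sub2 (sub1 (hb b)), ?_⟩
      · rw [Finset.card_insert_of_notMem hn]; omega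
      · intro p1 g1 x1 p1' hm hp1
        rcases Finset.mem_insert.1 hm with e | hm
        · simp at e
          obtain ⟨rfl, rfl⟩ := e
          obtain ⟨rfl, _⟩ := hP.det hD hp1
          exact h2
        · exact (hpop _ _ _ _ hm hp1).mono (fun _ h => sub2 (sub1 h))
    have := hmax _ hg
    rw [Finset.card_insert_of_notMem hn] at this
    omega
  have hOS : ∀ p g o p' w, D p g o p' w → HasW S o := by
    intro p g o p' w h
    rcases hO _ _ _ _ _ h with rfl | ⟨b, rfl⟩
    · exact Or.inl rfl
    · exact Or.inr (hb b)
  have hall : ∀ p g x p', MPop D p g x p' → (p, g) ∈ T := by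
    intro p g x p' h
    induction h with
    | @pop p g o p' h =>
      exact hins p g o [] [] p' (by simpa using MPop.pop h) (hOS _ _ _ _ _ h) (.inl rfl) (.inl rfl)
    | @repl p g o p1 g1 x p' h k ih =>
      exact hins p g o x [] p' (by simpa using MPop.repl h k) (hOS _ _ _ _ _ h)
        (hpop _ _ _ _ ih k) (.inl rfl)
    | @push p g o p1 g1 g2 x p2 y p' h k l ih1 ih2 =>
      exact hins p g o x y p' (MPop.push h k l) (hOS _ _ _ _ _ h)
        (hpop _ _ _ _ ih1 k) (hpop _ _ _ _ ih2 l)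
  refine ⟨S, hS, ?_, hb, fun p g x p' h => hpop _ _ _ _ (hall _ _ _ _ h) h⟩
  have hc : T.card ≤ Nat.card P * Nat.card Γ := by
    rw [← Nat.card_prod, Nat.card_eq_fintype_card]
    exact Finset.card_le_univ T
  omega

/-- One macro step of the non-popping chain. -/
theorem chain_step {S : List (List Bool)}
    (hOS : ∀ p g o p' w, D p g o p' w → HasW S o)
    (hpop : ∀ p g x p', MPop D p g x p' → HasW S x)
    (hlen : ∀ p g o p' w, D p g o p' w → w.length ≤ 2)
    (a : P × Γ) (ha : MNonpop D a) :
    ∃ (e x : List Bool) (a' : P × Γ), HasW S e ∧ HasW S x ∧ MNonpop D a' ∧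
      ((∀ r, ∃ n r', 1 ≤ n ∧ MRun D (a.1, a.2 :: r) n (e ++ x) (a'.1, a'.2 :: r')) ∨
       (e = [] ∧ x = [] ∧ a' = a ∧ ∀ o p' w, ¬ D a.1 a.2 o p' w)) := by
  obtain ⟨p, g⟩ := a
  by_cases hst : ∃ o p' w, D p g o p' w
  · obtain ⟨o, p', w, hd⟩ := hst
    have hl := hlen _ _ _ _ _ hd
    match w, hl with
    | [], _ => exact absurd (MPop.pop hd) (ha _ _)
    | [g1], _ =>
      refine ⟨o, [], (p', g1), hOS _ _ _ _ _ hd, .inl rfl, ?_, .inl ?_⟩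
      · intro x q hq
        exact ha _ _ (MPop.repl hd hq)
      · intro r
        exact ⟨1, r, le_rfl, by simpa using MRun.one (r := r) hd⟩
    | [g1, g2], _ =>
      by_cases hp : ∃ x q, MPop D p' g1 x q
      · obtain ⟨x, q, hq⟩ := hp
        refine ⟨o, x, (q, g2), hOS _ _ _ _ _ hd, hpop _ _ _ _ hq, ?_, .inl ?_⟩
        · intro y q' hq'
          exact ha _ _ (MPop.push hd hq hq')
        · intro r
          obtain ⟨n, hn, hr⟩ := hq.run (g2 :: r)
          exact ⟨1 + n, r, by omega, (MRun.one (r := r) hd).trans hr⟩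
      · push Not at hp
        refine ⟨o, [], (p', g1), hOS _ _ _ _ _ hd, .inl rfl, hp, .inl ?_⟩
        intro r
        exact ⟨1, g2 :: r, le_rfl, by simpa using MRun.one (r := r) hd⟩
  · push Not at hst
    exact ⟨[], [], (p, g), .inl rfl, .inl rfl, ha, .inr ⟨rfl, rfl, rfl, hst⟩⟩

/-- The output of the machine is an initial part of an ultimately periodic word `u w^ω`
with `u`, `w` produced by a small straight-line list. -/
theorem machine_lasso [Finite P] [Finite Γ] (hD : MDet D)
    (hO : ∀ p g o p' w, D p g o p' w → o = [] ∨ ∃ b, o = [b])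
    (hlen : ∀ p g o p' w, D p g o p' w → w.length ≤ 2)
    (p0 : P) (g0 : Γ) (h0 : MNonpop D (p0, g0)) :
    ∃ S u w, SLList S ∧ S.length ≤ 2 + 4 * (Nat.card P * Nat.card Γ) ∧ (∀ b : Bool, [b] ∈ S) ∧
      HasW S u ∧ HasW S w ∧
      (∀ k, ∃ n c, MRun D (p0, [g0]) n (u ++ (List.replicate k w).flatten) c) ∧
      (∀ n o c, MRun D (p0, [g0]) n o c → ∃ k, o <+: u ++ (List.replicate k w).flatten) := by
  classical
  have := Fintype.ofFinite P
  have := Fintype.ofFinite Γ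
  obtain ⟨S, hS, hSl, hb, hpop⟩ := exists_popList hD hO
  have hOS : ∀ p g o p' w, D p g o p' w → HasW S o := by
    intro p g o p' w h
    rcases hO _ _ _ _ _ h with rfl | ⟨b, rfl⟩
    · exact Or.inl rfl
    · exact Or.inr (hb b)
  let N := {a : P × Γ // MNonpop D a}
  have hstep : ∀ a : N, ∃ (e x : List Bool) (a' : N), HasW S e ∧ HasW S x ∧
      ((∀ r, ∃ n r', 1 ≤ n ∧ MRun D (a.1.1, a.1.2 :: r) n (e ++ x) (a'.1.1, a'.1.2 :: r')) ∨
       (e = [] ∧ x = [] ∧ a' = a ∧ ∀ o p' w, ¬ D a.1.1 a.1.2 o p' w)) := by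
    intro a
    obtain ⟨e, x, a', h1, h2, h3, h4⟩ := chain_step hOS hpop hlen a.1 a.2
    refine ⟨e, x, ⟨a', h3⟩, h1, h2, ?_⟩
    exact h4.imp id (fun ⟨k1, k2, k3, k4⟩ => ⟨k1, k2, Subtype.ext k3, k4⟩)
  choose e x nx he hx hrun using hstep
  let a0 : N := ⟨(p0, g0), h0⟩
  let outp : ℕ → N → List Bool := fun t =>
    Nat.rec (fun _ => []) (fun _ f a => (e a ++ x a) ++ f (nx a)) t
  have outp0 : ∀ a, outp 0 a = [] := fun a => rfl
  have outpS : ∀ t a, outp (t + 1) a = (e a ++ x a) ++ outp t (nx a) := fun t a => rfl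
  have outp_add : ∀ s t a, outp (s + t) a = outp s a ++ outp t (nx^[s] a) := by
    intro s
    induction s with
    | zero => intro t a; simp [outp0]
    | succ s ih =>
      intro t a
      rw [show s + 1 + t = (s + t) + 1 by omega, outpS, outpS, ih]
      simp
  -- compression of the chain outputs
  have hcomp : ∀ t a S', SLList S' → S ⊆ S' → ∃ S2, SLList S2 ∧ S' ⊆ S2 ∧
      S2.length ≤ S'.length + 2 * t ∧ HasW S2 (outp t a) := by
    intro t
    induction t with
    | zero => intro a S' h1 h2; exact ⟨S', h1, fun _ h => h, by omega, .inl rfl⟩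
    | succ t ih =>
      intro a S' h1 h2
      obtain ⟨S2, k1, k2, k3, k4⟩ := ih (nx a) S' h1 h2
      have sub2 : S ⊆ S2 := fun _ h => k2 (h2 h)
      obtain ⟨S3, l1, l2, l3, l4⟩ := k1.ext_cat ((hx a).mono sub2) k4
      obtain ⟨S4, m1, m2, m3, m4⟩ := l1.ext_cat ((he a).mono (fun _ h => l2 (sub2 h))) l4
      refine ⟨S4, m1, fun _ h => m2 (l2 (k2 h)), by omega, ?_⟩
      rw [outpS, List.append_assoc]
      exact m4
  -- the chain is realised by runs
  have hreal : ∀ t, ∃ n r, MRun D (p0, [g0]) n (outp t a0)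
        ((nx^[t] a0).1.1, (nx^[t] a0).1.2 :: r) ∧
      (t ≤ n ∨ ∀ o p' w, ¬ D (nx^[t] a0).1.1 (nx^[t] a0).1.2 o p' w) := by
    intro t
    induction t with
    | zero => exact ⟨0, [], .refl, .inl le_rfl⟩
    | succ t ih =>
      obtain ⟨n, r, hr, hor⟩ := ih
      rw [outp_add t 1]
      simp only [outpS, outp0, List.append_nil, Function.iterate_succ_apply']
      rcases hrun (nx^[t] a0) with h | ⟨h1, h2, h3, h4⟩
      · obtain ⟨m, r', hm, hr'⟩ := h r
        refine ⟨n + m, r', hr.trans hr', ?_⟩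
        rcases hor with hle | hno
        · left; omega
        · exfalso
          have : ∀ {c m o c'}, MRun D c m o c' → 1 ≤ m → ∃ p g r o' p' w, c = (p, g :: r) ∧
              D p g o' p' w := by
            intro c m o c' h
            induction h with
            | refl => intro h; omega
            | @tail n o p g r o' p' w h hd ih =>
              intro _
              rcases Nat.eq_zero_or_pos n with rfl | hn
              · cases h
                exact ⟨p, g, r, o', p', w, rfl, hd⟩
              · exact ih hn
          obtain ⟨p, g, r2, o', p', w, e1, e2⟩ := this hr' hm
          simp only [Prod.mk.injEq, List.cons.injEq] at e1
          obtain ⟨rfl, rfl, _⟩ := e1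
          exact hno _ _ _ e2
      · rw [h1, h2, h3]
        exact ⟨n, r, by simpa using hr, .inr h4⟩
  have hdom : ∀ n o c, MRun D (p0, [g0]) n o c → ∀ t, n ≤ t → o <+: outp t a0 := by
    intro n o c h t hnt
    obtain ⟨m, r, hr, hor⟩ := hreal t
    by_cases hnm : n ≤ m
    · obtain ⟨o', e', _⟩ := h.compare hD hr hnm
      exact ⟨o', e'.symm⟩
    · exfalso
      rcases hor with h1 | h1
      · omega
      · obtain ⟨o', -, h2⟩ := hr.compare hD h (by omega)
        have : ∀ {c m o c'}, MRun D c m o c' → 1 ≤ m → ∃ p g r o' p' w, c = (p, g :: r) ∧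
            D p g o' p' w := by
          intro c m o c' h
          induction h with
          | refl => intro h; omega
          | @tail n o p g r o' p' w h hd ih =>
            intro _
            rcases Nat.eq_zero_or_pos n with rfl | hn
            · cases h
              exact ⟨p, g, r, o', p', w, rfl, hd⟩
            · exact ih hn
        obtain ⟨p, g, r2, o', p', w, e1, e2⟩ := this h2 (by omega)
        simp only [Prod.mk.injEq, List.cons.injEq] at e1
        obtain ⟨rfl, rfl, _⟩ := e1
        exact h1 _ _ _ e2
  -- pigeonhole
  set M := Nat.card P * Nat.card Γ with hM
  have hcard : Nat.card N ≤ M := by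
    rw [hM, ← Nat.card_prod]
    exact Nat.card_le_card_of_injective _ Subtype.val_injective
  obtain ⟨t1, t2, hlt, hle, heq⟩ : ∃ t1 t2, t1 < t2 ∧ t2 ≤ M ∧ nx^[t1] a0 = nx^[t2] a0 := by
    have hni : ¬ Function.Injective (fun i : Fin (M + 1) => nx^[(i : ℕ)] a0) := by
      intro hinj
      have := Nat.card_le_card_of_injective _ hinj
      simp at this
      have h2 : Fintype.card N = Nat.card N := Nat.card_eq_fintype_card.symm
      omega
    simp only [Function.Injective, not_forall] at hni
    obtain ⟨i, j, hij, hne⟩ := hni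
    have hne' : (i : ℕ) ≠ j := fun h => hne (Fin.ext h)
    rcases Nat.lt_or_gt_of_ne hne' with h | h
    · exact ⟨i, j, h, by omega, hij⟩
    · exact ⟨j, i, h, by omega, hij.symm⟩
  obtain ⟨d, rfl⟩ : ∃ d, t2 = t1 + d := ⟨t2 - t1, by omega⟩
  have hloop : nx^[d] (nx^[t1] a0) = nx^[t1] a0 := by
    rw [← Function.iterate_add_apply, Nat.add_comm d t1]; exact heq.symm
  obtain ⟨S1, k1, k2, k3, k4⟩ := hcomp t1 a0 S hS (fun _ h => h)
  obtain ⟨S2, l1, l2, l3, l4⟩ := hcomp d (nx^[t1] a0) S1 k1 k2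
  have hper : ∀ k, outp (t1 + k * d) a0 =
      outp t1 a0 ++ (List.replicate k (outp d (nx^[t1] a0))).flatten := by
    intro k
    rw [outp_add]
    congr 1
    induction k with
    | zero => simp [outp0]
    | succ k ih =>
      rw [show (k + 1) * d = d + k * d by ring, outp_add, hloop, ih, List.replicate_succ,
        List.flatten_cons]
  refine ⟨S2, outp t1 a0, outp d (nx^[t1] a0), l1, by omega, fun b => l2 (k2 (hb b)),
    k4.mono l2, l4, ?_, ?_⟩
  · intro k
    obtain ⟨n, r, hr, _⟩ := hreal (t1 + k * d)
    rw [hper] at hr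
    exact ⟨n, _, hr⟩
  · intro n o c h
    refine ⟨n, ?_⟩
    rw [← hper]
    refine hdom n o c h _ ?_
    have : 1 ≤ d := by omega
    nlinarith

end Machine

/-! ### From udpda to machines -/

namespace UDPDA

variable {Q Γ : Type}

open Classical in
/-- The machine that outputs the characteristic sequence of the language: its states
remember whether a final state has been seen since the last letter was read. -/
def mach (A : UDPDA Q Γ) : Q × Bool → Γ → List Bool → Q × Bool → List Γ → Prop :=
  fun p g o p' w => ∃ σ w0, (p.1, σ, g, p'.1, w0) ∈ A.δ ∧
    w = (if g = A.bot ∧ w0 = [] then [A.bot] else w0) ∧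
    o = (if σ then [p.2] else []) ∧
    p'.2 = ((!σ && p.2) || decide (p'.1 ∈ A.final))

open Classical in
/-- Initial state of the machine. -/
noncomputable def minit (A : UDPDA Q Γ) : Q × Bool := (A.init, decide (A.init ∈ A.final))

theorem isStack_cons (A : UDPDA Q Γ) {g : Γ} {r : List Γ} (h : A.IsStack (g :: r)) :
    (g = A.bot ∧ r = []) ∨ (g ≠ A.bot ∧ A.IsStack r) := by
  obtain ⟨s', h1, h2⟩ := h
  cases s' with
  | nil => left; simpa using h2
  | cons a s' =>
    right
    simp at h1 h2
    refine ⟨?_, s', h1.2, h2.2⟩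
    rw [h2.1]; exact fun h => h1.1 h.symm

open Classical in
theorem mach_det (A : UDPDA Q Γ) : MDet A.mach := by
  rintro ⟨q, b⟩ g o ⟨q', b'⟩ w o2 ⟨q2, b2⟩ w2 ⟨σ, w0, h1, rfl, rfl, h2⟩ ⟨τ, v0, k1, rfl, rfl, k2⟩
  simp only at h1 h2 k1 k2
  have key : ∃ r, A.IsStack (g :: r) ∧ (g = A.bot → r = []) := by
    by_cases hg : g = A.bot
    · exact ⟨[], ⟨[], by simp, by simp [hg]⟩, fun _ => rfl⟩
    · exact ⟨[A.bot], ⟨[g], by simpa using fun h => hg h.symm, by simp⟩, fun h => absurd h hg⟩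
  obtain ⟨r, hr, hr'⟩ := key
  have mv : ∀ σ q' w0, (q, σ, g, q', w0) ∈ A.δ →
      A.Move (q, g :: r) σ (q', (if g = A.bot ∧ w0 = [] then [A.bot] else w0) ++ r) := by
    intro σ q' w0 h
    refine ⟨g, w0, h, ?_⟩
    by_cases hc : g = A.bot ∧ w0 = []
    · right
      have := hr' hc.1
      subst this
      simp [hc]
    · left
      refine ⟨by tauto, r, rfl, by simp [hc]⟩
  obtain ⟨rfl, e⟩ := A.det (q, g :: r) _ _ _ _ hr (mv _ _ _ h1) (mv _ _ _ k1)
  simp only [Prod.mk.injEq, List.append_cancel_right_eq] at e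
  obtain ⟨rfl, e⟩ := e
  exact ⟨rfl, by rw [h2, k2], e⟩

theorem mach_out (A : UDPDA Q Γ) : ∀ p g o p' w, A.mach p g o p' w → o = [] ∨ ∃ b, o = [b] := by
  rintro p g o p' w ⟨σ, w0, _, _, rfl, _⟩
  cases σ <;> simp

theorem mach_len (A : UDPDA Q Γ) : ∀ p g o p' w, A.mach p g o p' w → w.length ≤ 2 := by
  rintro p g o p' w ⟨σ, w0, h, rfl, _, _⟩
  have := (A.wf _ _ _ _ _ h).1
  split <;> simp [this]

theorem mach_bot (A : UDPDA Q Γ) {p o p' w} (h : A.mach p A.bot o p' w) :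
    ∃ w', A.bot ∉ w' ∧ w = w' ++ [A.bot] := by
  obtain ⟨σ, w0, h, rfl, _, _⟩ := h
  have := (A.wf _ _ _ _ _ h).2
  by_cases hw : w0 = []
  · exact ⟨[], by simp [hw]⟩
  · simpa [hw] using this

theorem mach_nonbot (A : UDPDA Q Γ) {p g o p' w} (h : A.mach p g o p' w) (hg : g ≠ A.bot) :
    A.bot ∉ w := by
  obtain ⟨σ, w0, h, rfl, _, _⟩ := h
  have := (A.wf _ _ _ _ _ h).2
  simpa [hg] using this

theorem mach_stack (A : UDPDA Q Γ) {p g o p' w r} (h : A.mach p g o p' w)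
    (hr : A.IsStack (g :: r)) : A.IsStack (w ++ r) := by
  rcases A.isStack_cons hr with ⟨rfl, rfl⟩ | ⟨hg, s', h1, rfl⟩
  · rw [List.append_nil]; exact A.mach_bot h
  · exact ⟨w ++ s', by simpa using ⟨A.mach_nonbot h hg, h1⟩, by simp⟩

theorem mach_nonpop (A : UDPDA Q Γ) (p : Q × Bool) : MNonpop A.mach (p, A.bot) := by
  have aux : ∀ p g x p', MPop A.mach p g x p' → g ≠ A.bot := by
    intro p g x p' h
    induction h with
    | pop h =>
      rintro rfl
      obtain ⟨w', _, e⟩ := A.mach_bot h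
      simp at e
    | @repl p g o p1 g1 x p' h _ ih =>
      rintro rfl
      obtain ⟨w', _, e⟩ := A.mach_bot h
      rw [show [g1] = [] ++ [g1] from rfl] at e
      have := List.append_inj' e rfl
      simp at this
      exact ih this.2
    | @push p g o p1 g1 g2 x p2 y p' h _ _ _ ih =>
      rintro rfl
      obtain ⟨w', _, e⟩ := A.mach_bot h
      rw [show [g1, g2] = [g1] ++ [g2] from rfl] at e
      have := List.append_inj' e rfl
      simp at this
      exact ih this.2
  intro x p' h
  exact aux _ _ _ _ h rfl

open Classical in
theorem sim (A : UDPDA Q Γ) {k : ℕ} {c : Q × List Γ} (h : A.Steps (A.init, [A.bot]) k c) :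
    A.IsStack c.2 ∧ ∃ n o b, MRun A.mach (A.minit, [A.bot]) n o ((c.1, b), c.2) ∧
      o.length = k ∧ (c.1 ∈ A.final → b = true) := by
  induction h with
  | refl =>
    exact ⟨⟨[], by simp⟩, 0, [], _, .refl, rfl, by simp⟩
  | @tail k c2 σ c3 h mv ih =>
    obtain ⟨hs, n, o, b, hr, hl, hb⟩ := ih
    obtain ⟨q2, s2⟩ := c2
    obtain ⟨q3, s3⟩ := c3
    obtain ⟨g, w, hd, hor⟩ := mv
    simp only at hs hr hd hor
    have hm : A.mach (q2, b) g (if σ then [b] else [])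
        (q3, (!σ && b) || decide (q3 ∈ A.final))
        (if g = A.bot ∧ w = [] then [A.bot] else w) := ⟨σ, w, hd, rfl, rfl, rfl⟩
    obtain ⟨r, rfl, rfl⟩ : ∃ r, s2 = g :: r ∧
        s3 = (if g = A.bot ∧ w = [] then [A.bot] else w) ++ r := by
      rcases hor with ⟨h1, r, h2, h3⟩ | ⟨h1, h2, h3, h4⟩
      · refine ⟨r, h2, ?_⟩
        rw [if_neg (by tauto)]; exact h3
      · exact ⟨[], by rw [h1]; exact h3, by simp [h1, h2, h4]⟩
    refine ⟨A.mach_stack hm hs, n + 1, _, _, .tail hr hm, ?_, ?_⟩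
    · cases σ <;> simp [hl]
    · intro hf
      simp [show q3 ∈ A.final from hf]

open Classical in
theorem sound (A : UDPDA Q Γ) {n : ℕ} {o : List Bool} {c : (Q × Bool) × List Γ}
    (h : MRun A.mach (A.minit, [A.bot]) n o c) :
    A.IsStack c.2 ∧ A.Steps (A.init, [A.bot]) o.length (c.1.1, c.2) ∧
      (c.1.2 = true → o.length ∈ A.lang) ∧ ∀ i, o[i]? = some true → i ∈ A.lang := by
  induction h with
  | refl =>
    refine ⟨⟨[], by simp⟩, .refl _, ?_, by simp⟩
    intro h
    simp [minit] at h
    exact ⟨_, .refl _, h⟩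
  | @tail n o p g r o' p' w h hd ih =>
    obtain ⟨hs, hst, hb, hi⟩ := ih
    have hs' := A.mach_stack hd hs
    obtain ⟨σ, w0, hδ, rfl, rfl, hb'⟩ := hd
    simp only at hs hst hb
    have mv : A.Move (p.1, g :: r) σ
        (p'.1, (if g = A.bot ∧ w0 = [] then [A.bot] else w0) ++ r) := by
      refine ⟨g, w0, hδ, ?_⟩
      by_cases hc : g = A.bot ∧ w0 = []
      · right
        rcases A.isStack_cons hs with ⟨_, rfl⟩ | ⟨h1, _⟩
        · simp [hc]
        · exact absurd hc.1 h1
      · left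
        exact ⟨by tauto, r, rfl, by simp [hc]⟩
    have st : A.Steps (A.init, [A.bot]) (o ++ if σ then [p.2] else []).length
        (p'.1, (if g = A.bot ∧ w0 = [] then [A.bot] else w0) ++ r) := by
      have := PrePDA.Steps.tail hst mv
      cases σ <;> simpa using this
    refine ⟨hs', st, ?_, ?_⟩
    · intro h
      simp only at h
      rw [h] at hb'
      by_cases hf : p'.1 ∈ A.final
      · exact ⟨_, st, hf⟩
      · cases σ with
        | true => simp [hf] at hb'
        | false => simp [hf] at hb'; simpa using hb hb'
    · intro i h
      cases σ with
      | false => exact hi i (by simpa using h)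
      | true =>
        rcases Nat.lt_or_ge i o.length with hlt | hge
        · rw [List.getElem?_append_left hlt] at h
          exact hi i h
        · rw [List.getElem?_append_right hge] at h
          simp only [if_true] at h
          have hz : i - o.length = 0 := by
            by_contra hne
            rw [List.getElem?_eq_none (by simp; omega)] at h
            simp at h
          rw [hz] at h
          simp at h
          have : i = o.length := by omega
          rw [this]
          exact hb h

theorem head_true (A : UDPDA Q Γ) {n : ℕ} {o : List Bool} {q : Q} {s : List Γ}
    {c : (Q × Bool) × List Γ} (h : MRun A.mach ((q, true), s) n o c) :
    (o = [] ∧ c.1.2 = true) ∨ o[0]? = some true := by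
  induction h with
  | refl => left; simp
  | @tail n o p g r o' p' w h hd ih =>
    obtain ⟨σ, w0, hδ, rfl, rfl, hb'⟩ := hd
    rcases ih with ⟨rfl, h2⟩ | h2
    · simp only at h2
      cases σ with
      | true => right; simp [h2]
      | false => left; simp [h2] at hb'; simp [hb']
    · right
      cases o with
      | nil => simp at h2
      | cons a o => simpa using h2

theorem exists_run (A : UDPDA Q Γ) {i : ℕ} (hi : i ∈ A.lang) :
    ∃ n o q s, MRun A.mach (A.minit, [A.bot]) n o ((q, true), s) ∧ o.length = i := by
  obtain ⟨c, hst, hf⟩ := hi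
  obtain ⟨_, n, o, b, hr, hl, hb⟩ := A.sim hst
  rw [hb hf] at hr
  exact ⟨n, o, _, _, hr, hl⟩

theorem complete (A : UDPDA Q Γ) {n : ℕ} {o : List Bool} {c : (Q × Bool) × List Γ}
    (h : MRun A.mach (A.minit, [A.bot]) n o c) {i : ℕ} (hi : i ∈ A.lang) (hlt : i < o.length) :
    o[i]? = some true := by
  obtain ⟨m, o', q, s, hr, rfl⟩ := A.exists_run hi
  rcases Nat.le_total m n with hmn | hmn
  · obtain ⟨o2, rfl, h2⟩ := hr.compare A.mach_det h hmn
    rw [List.getElem?_append_right le_rfl, Nat.sub_self]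
    rcases A.head_true h2 with ⟨rfl, _⟩ | h3
    · simp at hlt
    · exact h3
  · obtain ⟨o2, rfl, h2⟩ := h.compare A.mach_det hr hmn
    simp at hlt

open Classical in
theorem run_char (A : UDPDA Q Γ) {n : ℕ} {o : List Bool} {c : (Q × Bool) × List Γ}
    (h : MRun A.mach (A.minit, [A.bot]) n o c) {i : ℕ} (hlt : i < o.length) :
    o[i]? = some (decide (i ∈ A.lang)) := by
  by_cases hi : i ∈ A.lang
  · simpa [hi] using A.complete h hi hlt
  · have h1 := (A.sound h).2.2.2 i
    rw [List.getElem?_eq_getElem hlt] at h1 ⊢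
    cases hb : o[i] with
    | true => exact absurd (h1 (by rw [hb])) hi
    | false => simp [hi]

end UDPDA

theorem getElem?_flatten_replicate (w : List Bool) (k j : ℕ) (h : j < k * w.length) :
    (List.replicate k w).flatten[j]? = w[j % w.length]? := by
  induction k generalizing j with
  | zero => simp at h
  | succ k ih =>
    rw [List.replicate_succ, List.flatten_cons]
    rcases Nat.lt_or_ge j w.length with hlt | hge
    · rw [List.getElem?_append_left hlt, Nat.mod_eq_of_lt hlt]
    · rw [List.getElem?_append_right hge, ih _ (by rw [Nat.succ_mul] at h; omega),
        Nat.mod_eq_sub_mod hge]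

/-- There is an absolute constant `C` such that for every
unary language `L ⊆ {a}*` and every udpda `A` of size `m` with `L(A) = L`,
there exists an indicator pair for `L` of size at most `C·m`. -/
theorem udpda_to_indicator_pair :
    ∃ C : ℕ, ∀ (Q Γ : Type) (A : UDPDA Q Γ) (L : Set ℕ), A.lang = L →
      ∃ P1 P2 : CnfSLP Bool,
        IsIndicatorPair P1 P2 L ∧ P1.size + P2.size ≤ C * A.size := by
  classical
  refine ⟨22, ?_⟩
  rintro Q Γ A L rfl
  have := A.finQ
  have := A.finΓ
  obtain ⟨S, u, w, hS, hlen, hb, hu, hw, hex, hall⟩ :=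
    machine_lasso A.mach_det A.mach_out A.mach_len A.minit A.bot (A.mach_nonpop _)
  have hsize : 1 ≤ A.size := by
    have : Nonempty Q := ⟨A.init⟩
    have : Nonempty Γ := ⟨A.bot⟩
    exact Nat.mul_pos Nat.card_pos Nat.card_pos
  have hlen' : S.length ≤ 2 + 8 * A.size := by
    have e : Nat.card (Q × Bool) * Nat.card Γ = 2 * A.size := by
      rw [Nat.card_prod, UDPDA.size]
      simp
      ring
    omega
  by_cases hwn : w = []
  · subst hwn
    obtain ⟨n, c, hc⟩ := hex 0
    simp only [List.replicate_zero, List.flatten_nil, List.append_nil] at hc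
    obtain ⟨S', hS', hsub, hl, hh⟩ := hS.ext_cat hu (Or.inr (hb (decide (u.length ∈ A.lang))))
    have hmem : u ++ [decide (u.length ∈ A.lang)] ∈ S' := by
      rcases hh with h | h
      · simp at h
      · exact h
    obtain ⟨P1, e1, s1⟩ := hS'.toSLP hmem
    obtain ⟨P2, e2, s2⟩ := hS.toSLP (hb false)
    refine ⟨P1, P2, ⟨fun i => decide (i ∈ A.lang), by simp, ?_⟩, by omega⟩
    rw [e1, e2]
    refine ⟨by simp, fun i => ?_⟩
    rcases Nat.lt_trichotomy i u.length with h | rfl | h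
    · rw [if_pos (by simp; omega), List.getElem?_append_left h]
      exact A.run_char hc h
    · simp
    · rw [if_neg (by simp; omega)]
      have : i ∉ A.lang := by
        intro hi
        obtain ⟨m, o, q, s, hr, hl⟩ := A.exists_run hi
        obtain ⟨k, hk⟩ := hall m o _ hr
        have := hk.length_le
        simp at this
        omega
      simp [this, Nat.mod_one]
  · obtain ⟨S', hS', hsub, hl, hh⟩ := hS.ext_cat hu hw
    have hmem : u ++ w ∈ S' := by
      rcases hh with h | h
      · simp [hwn] at h
      · exact h
    obtain ⟨P1, e1, s1⟩ := hS'.toSLP hmem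
    obtain ⟨P2, e2, s2⟩ := hS.toSLP (hw.resolve_left hwn)
    refine ⟨P1, P2, ⟨fun i => decide (i ∈ A.lang), by simp, ?_⟩, by omega⟩
    rw [e1, e2]
    refine ⟨hwn, fun i => ?_⟩
    have hpos : 1 ≤ w.length := List.length_pos_iff.2 hwn
    have hbig : i < (i + 1) * w.length := by nlinarith
    obtain ⟨n, c, hr⟩ := hex (i + 1)
    have hchar := A.run_char hr (i := i) (by simp; omega)
    rw [← hchar]
    rcases Nat.lt_or_ge i u.length with h | h
    · rw [if_pos (by simp; omega), List.getElem?_append_left h, List.getElem?_append_left h]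
    · rw [List.getElem?_append_right h (l₂ := (List.replicate (i + 1) w).flatten),
        getElem?_flatten_replicate _ _ _ (by omega)]
      split
      · rename_i h2
        simp at h2
        rw [List.getElem?_append_right h, Nat.mod_eq_of_lt (by omega)]
      · rename_i h2
        simp at h2
        rw [List.length_append, ← Nat.sub_sub, ← Nat.mod_eq_sub_mod (by omega)]
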